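/- Let k ≥ 2 be an even integer, a = π/k, and let q : (0,π) → ℂ be any function, with W_{1,0} the associated function. Then for every x ∈ (0,a), q(x) = ∑_{j=1}^{k/2} (−1)^j ( W_{1,0}((k+1−2j)a − x) + W_{1,0}((k+1−2j)a + x) ). -/

import Mathlib

/-- The function `W_{1,0}` associated with `q`, where `a = π/k`. -/
noncomputable def W10 (k : ℕ) (q : ℝ → ℂ) (t : ℝ) : ℂ :=
  let a := Real.pi / k
  if t ∈ Set.Ioo 0 a then
    (q (((k : ℝ) - 1) * a + t) - q (((k : ℝ) - 1) * a - t)) / 2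
  else if t ∈ Set.Ioo a (((k : ℝ) - 1) * a) then
    (-q (((k : ℝ) + 1) * a - t) - q (((k : ℝ) - 1) * a - t)) / 2
  else if t ∈ Set.Ioo (((k : ℝ) - 1) * a) Real.pi then
    -(q (((k : ℝ) + 1) * a - t) + q (t - ((k : ℝ) - 1) * a)) / 2
  else 0

section W10Values

variable {k : ℕ} {a t : ℝ}

theorem W10_of_mem_left (q : ℝ → ℂ) (ha : a = Real.pi / k) (h₀ : 0 < t) (h₁ : t < a) :
    W10 k q t = (q (((k : ℝ) - 1) * a + t) - q (((k : ℝ) - 1) * a - t)) / 2 := by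
  subst ha
  exact if_pos ⟨h₀, h₁⟩

theorem W10_of_mem_middle (q : ℝ → ℂ) (ha : a = Real.pi / k) (h₀ : a < t)
    (h₁ : t < ((k : ℝ) - 1) * a) :
    W10 k q t = (-q (((k : ℝ) + 1) * a - t) - q (((k : ℝ) - 1) * a - t)) / 2 := by
  subst ha
  exact (if_neg fun h => h₀.not_gt h.2).trans (if_pos ⟨h₀, h₁⟩)

theorem W10_of_mem_right (q : ℝ → ℂ) (ha : a = Real.pi / k) (h : a < t)
    (h₀ : ((k : ℝ) - 1) * a < t) (h₁ : t < Real.pi) :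
    W10 k q t = -(q (((k : ℝ) + 1) * a - t) + q (t - ((k : ℝ) - 1) * a)) / 2 := by
  subst ha
  exact (if_neg fun h' => h.not_gt h'.2).trans
    ((if_neg fun h' => h₀.not_gt h'.2).trans (if_pos ⟨h₀, h₁⟩))

end W10Values

/-- The sum `q (2ja + x) + q (2ja - x)`, with the boundary values that make the alternating sum
over `j = 0, …, n` telescope. -/
noncomputable def reflectedSum (n : ℕ) (q : ℝ → ℂ) (a x : ℝ) (j : ℕ) : ℂ :=
  if j = 0 then 2 * q x else if j = n then 0 else q (2 * j * a + x) + q (2 * j * a - x)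

theorem W10_sub_add_W10_add {n i : ℕ} (hi : i < n) (q : ℝ → ℂ) {a x : ℝ}
    (ha : a = Real.pi / (n + n : ℕ)) (hx₀ : 0 < x) (hx₁ : x < a) :
    W10 (n + n) q ((((n + n : ℕ) : ℝ) + 1 - 2 * (i + 1 : ℕ)) * a - x) +
        W10 (n + n) q ((((n + n : ℕ) : ℝ) + 1 - 2 * (i + 1 : ℕ)) * a + x) =
      -(reflectedSum n q a x (i + 1) + reflectedSum n q a x i) / 2 := by
  have hn : (0 : ℝ) < n := by exact_mod_cast (Nat.zero_le i).trans_lt hi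
  have hpi : Real.pi = 2 * (n * a) := by
    rw [ha]; push_cast; field_simp; ring
  have ha₀ : 0 < a := hx₀.trans hx₁
  have hminus : W10 (n + n) q ((((n + n : ℕ) : ℝ) + 1 - 2 * (i + 1 : ℕ)) * a - x) =
      ((if i + 1 = n then q (2 * n * a - x) else -q (2 * (i + 1 : ℕ) * a + x)) -
        q (2 * i * a + x)) / 2 := by
    split_ifs with h
    · have hc : (n : ℝ) = i + 1 := by exact_mod_cast h.symm
      rw [W10_of_mem_left q ha (by push_cast; rw [hc]; linarith)
        (by push_cast; rw [hc]; linarith)]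
      push_cast
      rw [hc]
      ring_nf
    · have h' : (i : ℝ) + 2 ≤ n := by exact_mod_cast (show i + 2 ≤ n by omega)
      have h1 := mul_le_mul_of_nonneg_right h' ha₀.le
      have h2 : 0 ≤ (i : ℝ) * a := by positivity
      rw [W10_of_mem_middle q ha (by push_cast; linarith) (by push_cast; linarith)]
      push_cast
      ring_nf
  have hplus : W10 (n + n) q ((((n + n : ℕ) : ℝ) + 1 - 2 * (i + 1 : ℕ)) * a + x) =
      (-q (2 * (i + 1 : ℕ) * a - x) - (if i = 0 then q x else q (2 * i * a - x))) / 2 := by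
    have h' : (i : ℝ) + 1 ≤ n := by exact_mod_cast hi
    have h1 := mul_le_mul_of_nonneg_right h' ha₀.le
    split_ifs with h
    · subst h
      push_cast at h1
      rw [W10_of_mem_right q ha (by push_cast; linarith) (by push_cast; linarith)
        (by push_cast; linarith)]
      push_cast
      ring_nf
    · have h3 : (1 : ℝ) ≤ i := by exact_mod_cast Nat.one_le_iff_ne_zero.2 h
      have h2 := mul_le_mul_of_nonneg_right h3 ha₀.le
      rw [W10_of_mem_middle q ha (by push_cast; linarith) (by push_cast; linarith)]
      push_cast
      ring_nf
  rw [hminus, hplus, reflectedSum, reflectedSum, if_neg i.succ_ne_zero, if_neg hi.ne]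
  split_ifs with h h0 h0
  · subst h h0; push_cast; ring_nf
  · subst h; ring
  · subst h0; push_cast; ring_nf
  · ring

theorem q_from_W10 (k : ℕ) (hk : 2 ≤ k) (heven : Even k) (q : ℝ → ℂ) :
    ∀ x ∈ Set.Ioo (0:ℝ) (Real.pi / k),
      q x = ∑ j ∈ Finset.Icc 1 (k / 2), (-1 : ℂ) ^ j *
        (W10 k q (((k : ℝ) + 1 - 2 * j) * (Real.pi / k) - x) +
          W10 k q (((k : ℝ) + 1 - 2 * j) * (Real.pi / k) + x)) := by
  rintro x ⟨hx₀, hx₁⟩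
  obtain ⟨n, rfl⟩ := heven
  have hn : n ≠ 0 := by omega
  rw [show (n + n) / 2 = n by omega, ← Finset.Ico_add_one_right_eq_Icc,
    Finset.sum_Ico_eq_sum_range, Nat.add_sub_cancel]
  have htel := Finset.sum_range_sub' (fun i => (-1 : ℂ) ^ i *
    reflectedSum n q (Real.pi / (n + n : ℕ)) x i / 2) n
  calc
    q x = _ := by simp [reflectedSum, hn]
    _ = _ := htel.symm
    _ = _ := Finset.sum_congr rfl fun i hi => by
      rw [add_comm 1 i, W10_sub_add_W10_add (Finset.mem_range.1 hi) q rfl hx₀ hx₁]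
      ring
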